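/- Let G be an MPG with limited-observation. No cyclic permutation of a good abstract cycle is bad: if ρ = o_0σ_0…o_n is a good abstract cycle and ρ' = o'_0σ'_0…o'_n is an abstract cycle with o'_j = o_{(j+k) mod n} and σ'_j = σ_{(j+k) mod n} for all j and some fixed k, then ρ' is not bad. -/

import Mathlib

open Classical

/-- A mean-payoff game (MPG) with partial-observation. -/
structure MPG where
  Q : Type
  A : Type
  fintypeQ : Fintype Q
  decEqQ : DecidableEq Q
  fintypeA : Fintype A
  nonemptyA : Nonempty A
  qI : Q
  delta : Q → A → Q → Prop
  total : ∀ q a, ∃ q', delta q a q'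
  w : Q → A → Q → ℤ
  Obs : Set (Set Q)
  partition : Setoid.IsPartition Obs

namespace MPG

variable (G : MPG)

/-- `post_σ(o)`. -/
def post (o : Set G.Q) (a : G.A) : Set G.Q :=
  {q' | ∃ q ∈ o, G.delta q a q'}

/-- Limited-observation condition. -/
def LimitedObs : Prop :=
  ({G.qI} : Set G.Q) ∈ G.Obs ∧
    ∀ o ∈ G.Obs, ∀ a : G.A, ∃ S ⊆ G.Obs, G.post o a = ⋃₀ S

/-- Infinite concrete paths, as sequences of state-action pairs. -/
def IsConcretePath (π : ℕ → G.Q × G.A) : Prop :=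
  ∀ i, G.delta (π i).1 (π i).2 (π (i + 1)).1

/-- weight of the first `n` transitions of a concrete path -/
def sumW (π : ℕ → G.Q × G.A) (n : ℕ) : ℤ :=
  ∑ i ∈ Finset.range n, G.w (π i).1 (π i).2 (π (i + 1)).1

/-- Mean payoff (`liminf`). -/
noncomputable def MP (π : ℕ → G.Q × G.A) : ℝ :=
  Filter.liminf (fun n => (G.sumW π n : ℝ) / (n : ℝ)) Filter.atTop

/-- Infinite abstract paths, as sequences of observation-action pairs. -/
def IsAbstractPath (ψ : ℕ → Set G.Q × G.A) : Prop :=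
  (∀ i, (ψ i).1 ∈ G.Obs) ∧
    ∀ i, ∃ q ∈ (ψ i).1, ∃ q' ∈ (ψ (i + 1)).1, G.delta q (ψ i).2 q'

/-- `γ(ψ)`: concrete paths compatible with an abstract path. -/
def gamma (ψ : ℕ → Set G.Q × G.A) : Set (ℕ → G.Q × G.A) :=
  {π | G.IsConcretePath π ∧ ∀ i, (π i).1 ∈ (ψ i).1 ∧ (π i).2 = (ψ i).2}

/-- A play: an infinite abstract path starting at the observation containing `qI`. -/
def IsPlay (ψ : ℕ → Set G.Q × G.A) : Prop :=
  G.IsAbstractPath ψ ∧ G.qI ∈ (ψ 0).1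

def WinningForEve (ψ : ℕ → Set G.Q × G.A) : Prop :=
  ∀ π ∈ G.gamma ψ, 0 ≤ G.MP π

def WinningForAdam (ψ : ℕ → Set G.Q × G.A) : Prop :=
  ∃ π ∈ G.gamma ψ, G.MP π < 0

/-- the prefix `o₀σ₀…o_{i-1}σ_{i-1}` of a play -/
def hist (ψ : ℕ → Set G.Q × G.A) (i : ℕ) : List (Set G.Q × G.A) :=
  (List.range i).map ψ

/-- An observation-based strategy for Eve: from a play prefix
`o₀σ₀…o_{n-1}σ_{n-1}` together with the current observation `o_n`, choose an action. -/
def EveStrategy : Type :=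
  List (Set G.Q × G.A) → Set G.Q → G.A

def ConsistentE (st : G.EveStrategy) (ψ : ℕ → Set G.Q × G.A) : Prop :=
  ∀ i, (ψ i).2 = st (G.hist ψ i) (ψ i).1

def EveWinningStrategy (st : G.EveStrategy) : Prop :=
  ∀ ψ, G.IsPlay ψ → G.ConsistentE st ψ → G.WinningForEve ψ

/-- Eve's strategy `st` has memory `m`. -/
def HasMemory (st : G.EveStrategy) (m : ℕ) : Prop :=
  ∃ (M : Type) (inst : Fintype M) (m0 : M)
    (αu : M → Set G.Q → M) (αo : M → Set G.Q → G.A),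
    @Fintype.card M inst = m ∧
      ∀ ψ : ℕ → Set G.Q × G.A, G.IsPlay ψ → ∀ i,
        st (G.hist ψ i) (ψ i).1 =
          αo ((G.hist ψ i).foldl (fun x p => αu x p.1) m0) (ψ i).1

def FiniteMemory (st : G.EveStrategy) : Prop :=
  ∃ m, G.HasMemory st m

/-- An observation-based strategy for Adam. -/
def AdamStrategy : Type :=
  List (Set G.Q × G.A) → Set G.Q → G.A → Set G.Q

def AdamStrategyValid (st : G.AdamStrategy) : Prop :=
  ∀ ψ : ℕ → Set G.Q × G.A, G.IsPlay ψ → ∀ i, ∀ a : G.A,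
    st (G.hist ψ i) (ψ i).1 a ∈ G.Obs ∧
      (st (G.hist ψ i) (ψ i).1 a ∩ G.post (ψ i).1 a).Nonempty

def ConsistentA (st : G.AdamStrategy) (ψ : ℕ → Set G.Q × G.A) : Prop :=
  ∀ i, (ψ (i + 1)).1 = st (G.hist ψ i) (ψ i).1 (ψ i).2

def AdamWinningStrategy (st : G.AdamStrategy) : Prop :=
  G.AdamStrategyValid st ∧
    ∀ ψ, G.IsPlay ψ → G.ConsistentA st ψ → G.WinningForAdam ψ

/-- Adam's strategy `st` has memory `m`. -/
def AdamHasMemory (st : G.AdamStrategy) (m : ℕ) : Prop :=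
  ∃ (M : Type) (inst : Fintype M) (m0 : M)
    (αu : M → Set G.Q → G.A → M) (αo : M → Set G.Q → G.A → Set G.Q),
    @Fintype.card M inst = m ∧
      ∀ ψ : ℕ → Set G.Q × G.A, G.IsPlay ψ → ∀ i, ∀ a : G.A,
        st (G.hist ψ i) (ψ i).1 a =
          αo ((G.hist ψ i).foldl (fun x p => αu x p.1 p.2) m0) (ψ i).1 a

/-- The set `F` of functions `Q → ℤ ∪ {+∞, ⊥}`; `none` plays the role of `⊥`
and `some ⊤` the role of `+∞`. -/
abbrev FF : Type := G.Q → Option (WithTop ℤ)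

def Fsupp (f : G.FF) : Set G.Q := {q | f q ≠ none}

/-- The candidate values `f(q') + w(q',σ,q)` used in the definition of a σ-successor
(with the convention `+∞ + k = +∞`). -/
def transVals (f : G.FF) (a : G.A) (q : G.Q) : Set (WithTop ℤ) :=
  {x | ∃ q' v, f q' = some v ∧ G.delta q' a q ∧ x = v + (G.w q' a q : WithTop ℤ)}

def IsMinOf (m : WithTop ℤ) (s : Set (WithTop ℤ)) : Prop :=
  m ∈ s ∧ ∀ x ∈ s, m ≤ x

/-- `f'` is a σ-successor of `f`. -/
def IsSucc (f : G.FF) (a : G.A) (f' : G.FF) : Prop :=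
  G.Fsupp f' ∈ G.Obs ∧ G.Fsupp f' ⊆ G.post (G.Fsupp f) a ∧
    ∀ q ∈ G.Fsupp f', f' q = some ⊤ ∨
      ∃ m, f' q = some m ∧ IsMinOf m (G.transVals f a q)

/-- `f'` is a proper σ-successor of `f`. -/
def IsProperSucc (f : G.FF) (a : G.A) (f' : G.FF) : Prop :=
  G.IsSucc f a f' ∧
    ∀ q ∈ G.Fsupp f', ∃ m, f' q = some m ∧ IsMinOf m (G.transVals f a q)

/-- the order `f ⪯ₖ f'`. -/
def prec (k : ℕ) (f f' : G.FF) : Prop :=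
  G.Fsupp f = G.Fsupp f' ∧
    ∀ q ∈ G.Fsupp f, ∃ v v', f q = some v ∧ f' q = some v' ∧
      v + ((k : ℤ) : WithTop ℤ) ≤ v'

/-- positions of the reachability game associated with `G`: the sequence
`f₀σ₀f₁…σ_{n-1}fₙ` is represented by the list `[(f₀,σ₀),…,(f_{n-1},σ_{n-1})]`
together with the final function `fₙ`. -/
abbrev Pos : Type := List (G.FF × G.A) × G.FF

def fI : G.FF := fun q =>
  letI := G.decEqQ
  if q = G.qI then some ((0 : ℤ) : WithTop ℤ) else none

def initPos : G.Pos := ([], G.fI)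

/-- the `i`-th function of a position (the final one for `i ≥ length`). -/
def posFun (p : G.Pos) (i : ℕ) : G.FF :=
  if h : i < p.1.length then (p.1.get ⟨i, h⟩).1 else p.2

/-- membership in `Π_G`. -/
def ValidPos (p : G.Pos) : Prop :=
  G.posFun p 0 = G.fI ∧
    (∀ i (hi : i < p.1.length),
      G.IsSucc (G.posFun p i) (p.1.get ⟨i, hi⟩).2 (G.posFun p (i + 1))) ∧
    ∀ i j, i < j → j < p.1.length →
      ¬ G.prec 0 (G.posFun p i) (G.posFun p j) ∧
        ¬ G.prec 1 (G.posFun p j) (G.posFun p i)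

/-- membership in `T_E`. -/
def inTE (p : G.Pos) : Prop :=
  ∃ i < p.1.length, G.prec 0 (G.posFun p i) p.2

/-- membership in `T_A`. -/
def inTA (p : G.Pos) : Prop :=
  ∃ i < p.1.length, G.prec 1 p.2 (G.posFun p i) ∧
    ∃ q ∈ G.Fsupp (G.posFun p i), G.posFun p i q ≠ some ⊤

def TerminalPos (p : G.Pos) : Prop := G.inTE p ∨ G.inTA p

def extend (p : G.Pos) (a : G.A) (f : G.FF) : G.Pos :=
  (p.1 ++ [(p.2, a)], f)

/-- One step of the reachability game (with validity predicate `V`), consistent with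
Eve's strategy `sE`: at a terminal position the play stops (stutters); otherwise Eve
plays `sE p` and Adam picks any successor giving a valid position (if there is none,
the play stutters). -/
def EveNext (V : G.Pos → Prop) (sE : G.Pos → G.A) (p p' : G.Pos) : Prop :=
  (G.TerminalPos p → p' = p) ∧
    (¬ G.TerminalPos p →
      (∃ f, p' = G.extend p (sE p) f ∧ V p') ∨
        ((¬ ∃ f, V (G.extend p (sE p) f)) ∧ p' = p))

/-- Eve wins the reachability game with positions `V` using strategy `sE`. -/
def EveWinningR (V : G.Pos → Prop) (sE : G.Pos → G.A) : Prop :=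
  ∀ ps : ℕ → G.Pos, ps 0 = G.initPos →
    (∀ k, G.EveNext V sE (ps k) (ps (k + 1))) → ∃ k, G.inTE (ps k)

/-- One step of the reachability game, consistent with Adam's strategy `sA`. -/
def AdamNext (V : G.Pos → Prop) (sA : G.Pos → G.A → G.FF) (p p' : G.Pos) : Prop :=
  (G.TerminalPos p → p' = p) ∧
    (¬ G.TerminalPos p → ∃ a : G.A,
      (V (G.extend p a (sA p a)) ∧ p' = G.extend p a (sA p a)) ∨
        ((¬ ∃ f, V (G.extend p a f)) ∧ p' = p))

/-- Adam wins the reachability game with positions `V` using strategy `sA`. -/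
def AdamWinningR (V : G.Pos → Prop) (sA : G.Pos → G.A → G.FF) : Prop :=
  ∀ ps : ℕ → G.Pos, ps 0 = G.initPos →
    (∀ k, G.AdamNext V sA (ps k) (ps (k + 1))) → ∃ k, G.inTA (ps k)

/-- `G` is forcibly terminating: some player wins `Γ_G`. -/
def ForciblyTerminating : Prop :=
  (∃ sE, G.EveWinningR G.ValidPos sE) ∨ (∃ sA, G.AdamWinningR G.ValidPos sA)

/-- membership in `Π'_G`: positions of `Γ'_G` (pairwise distinct supports). -/
def ValidPos' (p : G.Pos) : Prop :=
  G.ValidPos p ∧ ∀ i j, i < j → j < p.1.length →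
    G.Fsupp (G.posFun p i) ≠ G.Fsupp (G.posFun p j)

/-- `G` is forcibly FAC: some player wins `Γ'_G`. -/
def ForciblyFAC : Prop :=
  (∃ sE, G.EveWinningR G.ValidPos' sE) ∨ (∃ sA, G.AdamWinningR G.ValidPos' sA)

/-- `G` is FAC: every leaf of `Γ'_G` is terminal. -/
def FAC : Prop :=
  ∀ p, G.ValidPos' p → (¬ ∃ a f, G.ValidPos' (G.extend p a f)) →
    G.inTE p ∨ G.inTA p

end MPG

namespace MPG

/-- A (finite) abstract cycle `o₀σ₀…oₙ` with `oₙ = o₀`. -/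
structure AbsCycle (G : MPG) where
  n : ℕ
  npos : 0 < n
  obs : ℕ → Set G.Q
  act : ℕ → G.A
  mem : ∀ i ≤ n, obs i ∈ G.Obs
  path : ∀ i < n, ∃ q ∈ obs i, ∃ q' ∈ obs (i + 1), G.delta q (act i) q'
  closed : obs n = obs 0

variable (G : MPG)

/-- A good abstract cycle. -/
def Good (c : AbsCycle G) : Prop :=
  ∃ fs : ℕ → G.FF,
    (∀ i ≤ c.n, G.Fsupp (fs i) = c.obs i) ∧
    (∀ i < c.n, G.IsSucc (fs i) (c.act i) (fs (i + 1))) ∧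
    (∀ i ≤ c.n, ∀ q ∈ G.Fsupp (fs i), fs i q ≠ some ⊤) ∧
    G.prec 0 (fs 0) (fs c.n)

/-- A bad abstract cycle. -/
def Bad (c : AbsCycle G) : Prop :=
  ∃ fs : ℕ → G.FF,
    (∀ i ≤ c.n, G.Fsupp (fs i) = c.obs i) ∧
    (∀ i < c.n, G.IsSucc (fs i) (c.act i) (fs (i + 1))) ∧
    (∃ q ∈ G.Fsupp (fs 0), fs 0 q ≠ some ⊤) ∧
    G.prec 1 (fs c.n) (fs 0)

end MPG

namespace MPG

variable {G : MPG}

lemma IsSucc.le_add_weight {f f' : G.FF} {a : G.A} (h : G.IsSucc f a f') {q q' : G.Q} {x y : ℤ}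
    (hx : f q = some (x : WithTop ℤ)) (hy : f' q' = some (y : WithTop ℤ))
    (hd : G.delta q a q') : y ≤ x + G.w q a q' := by
  have hq' : q' ∈ G.Fsupp f' := by simp [Fsupp, hy]
  rcases h.2.2 q' hq' with htop | ⟨m, hm, -, hmin⟩
  · simp [hy] at htop
  · obtain rfl : (y : WithTop ℤ) = m := Option.some.inj (hy.symm.trans hm)
    exact_mod_cast hmin _ ⟨q, x, hx, hd, rfl⟩

lemma IsSucc.exists_pred {f f' : G.FF} {a : G.A} (h : G.IsSucc f a f') {q' : G.Q} {y : ℤ}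
    (hy : f' q' = some (y : WithTop ℤ)) :
    ∃ q, ∃ x : ℤ, f q = some (x : WithTop ℤ) ∧ G.delta q a q' ∧ y = x + G.w q a q' := by
  have hq' : q' ∈ G.Fsupp f' := by simp [Fsupp, hy]
  rcases h.2.2 q' hq' with htop | ⟨m, hm, ⟨q, v, hv, hd, hmv⟩, -⟩
  · simp [hy] at htop
  · obtain rfl : (y : WithTop ℤ) = m := Option.some.inj (hy.symm.trans hm)
    cases v with
    | top => simp at hmv
    | coe x => exact ⟨q, x, hv, hd, by exact_mod_cast hmv⟩

/-- A good cycle carries a potential which increases along each concrete transition by at most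
the weight of that transition. -/
lemma Good.exists_potential {c : AbsCycle G} (h : G.Good c) :
    ∃ φ : ℕ → G.Q → ℤ, ∀ i < c.n, ∀ q ∈ c.obs i, ∀ q' ∈ c.obs ((i + 1) % c.n),
      G.delta q (c.act i) q' → φ ((i + 1) % c.n) q' ≤ φ i q + G.w q (c.act i) q' := by
  obtain ⟨fs, hsupp, hsucc, hfin, -, hle⟩ := h
  have hval : ∀ i q, ∃ x : ℤ, i ≤ c.n → q ∈ c.obs i → fs i q = some (x : WithTop ℤ) := by
    intro i q
    by_cases hi : i ≤ c.n ∧ q ∈ c.obs i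
    · have hq : q ∈ G.Fsupp (fs i) := by rw [hsupp i hi.1]; exact hi.2
      obtain ⟨v, hv⟩ := Option.ne_none_iff_exists'.mp hq
      cases v with
      | top => exact absurd hv (hfin i hi.1 q hq)
      | coe x => exact ⟨x, fun _ _ => hv⟩
    · exact ⟨0, fun h₁ h₂ => absurd ⟨h₁, h₂⟩ hi⟩
  choose φ hφ using hval
  refine ⟨φ, fun i hi q hq q' hq' hd => ?_⟩
  rcases Nat.lt_or_ge (i + 1) c.n with hlt | hge
  · rw [Nat.mod_eq_of_lt hlt] at hq' ⊢
    exact (hsucc i hi).le_add_weight (hφ i q hi.le hq) (hφ _ q' hlt.le hq') hd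
  · have hin : i + 1 = c.n := by omega
    rw [hin, Nat.mod_self] at hq' ⊢
    have hq'n : q' ∈ c.obs c.n := by rwa [c.closed]
    have hzero := hφ 0 q' (Nat.zero_le _) hq'
    have hlast := hφ c.n q' le_rfl hq'n
    obtain ⟨v, v', hv, hv', hvv'⟩ := hle q' (by rwa [hsupp 0 (Nat.zero_le _)])
    obtain rfl := Option.some.inj (hzero.symm.trans hv)
    obtain rfl := Option.some.inj (hlast.symm.trans hv')
    have hmono : φ 0 q' ≤ φ c.n q' := by simpa using hvv'
    exact hmono.trans <|
      (hsucc i hi).le_add_weight (hφ i q hi.le hq) (by rw [hin]; exact hlast) hd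

/-- A cycle carrying a periodic potential is not bad. -/
lemma not_bad_of_potential {c : AbsCycle G} (φ : ℕ → G.Q → ℤ) (hper : φ c.n = φ 0)
    (hφ : ∀ i < c.n, ∀ q ∈ c.obs i, ∀ q' ∈ c.obs (i + 1),
      G.delta q (c.act i) q' → φ (i + 1) q' ≤ φ i q + G.w q (c.act i) q') :
    ¬ G.Bad c := by
  rintro ⟨fs, hsupp, hsucc, ⟨q₀, hq₀, hq₀fin⟩, heq, hle⟩
  have hmem : ∀ i ≤ c.n, ∀ q, ∀ x : ℤ, fs i q = some (x : WithTop ℤ) → q ∈ c.obs i := by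
    intro i hi q x hx
    rw [← hsupp i hi]
    simp [Fsupp, hx]
  have hne : {q | ∃ x : ℤ, fs 0 q = some (x : WithTop ℤ)}.Nonempty := by
    obtain ⟨v, hv⟩ := Option.ne_none_iff_exists'.mp hq₀
    cases v with
    | top => exact absurd hv hq₀fin
    | coe x => exact ⟨q₀, x, hv⟩
  let := G.fintypeQ
  choose! val hval using fun q (hq : ∃ x : ℤ, fs 0 q = some (x : WithTop ℤ)) => hq
  obtain ⟨p, hp, hpmin⟩ :=
    Set.exists_min_image _ (fun q => val q - φ 0 q) (Set.toFinite _) hne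
  have hlower : ∀ i ≤ c.n, ∀ q, ∀ x : ℤ, fs i q = some (x : WithTop ℤ) →
      val p - φ 0 p ≤ x - φ i q := by
    intro i
    induction i with
    | zero =>
      intro _ q x hx
      have hqx := hval q ⟨x, hx⟩
      obtain rfl : x = val q := by simpa [hx] using hqx
      exact hpmin q ⟨_, hx⟩
    | succ i ih =>
      intro hi q' y hy
      obtain ⟨q, x, hx, hd, rfl⟩ := (hsucc i hi).exists_pred hy
      have hstep := hφ i hi q (hmem i (by omega) q x hx) q' (hmem _ hi q' _ hy) hd
      have hbound := ih (by omega) q x hx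
      omega
  have hpval := hval p hp
  have hpsupp : p ∈ G.Fsupp (fs c.n) := by
    rw [heq]
    simp [Fsupp, hpval]
  obtain ⟨v, v', hv, hv', hvv'⟩ := hle p hpsupp
  obtain rfl := Option.some.inj (hpval.symm.trans hv')
  cases v with
  | top => simp at hvv'
  | coe x =>
    have hdec : x + 1 ≤ val p := by exact_mod_cast hvv'
    have hbound := hlower c.n le_rfl p x hv
    rw [hper] at hbound
    omega

end MPG

/-- no cyclic permutation of a good abstract cycle is bad. -/
theorem cyclic_permutation_of_good_not_bad (G : MPG) (hG : G.LimitedObs)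
    (c c' : MPG.AbsCycle G) (hn : c'.n = c.n) (k : ℕ)
    (hobs : ∀ j ≤ c'.n, c'.obs j = c.obs ((j + k) % c.n))
    (hact : ∀ j < c'.n, c'.act j = c.act ((j + k) % c.n))
    (hgood : G.Good c) : ¬ G.Bad c' := by
  obtain ⟨φ, hφ⟩ := hgood.exists_potential
  refine MPG.not_bad_of_potential (fun j => φ ((j + k) % c.n)) (by simp [hn]) ?_
  intro j hj q hq q' hq' hd
  have hidx : (j + 1 + k) % c.n = ((j + k) % c.n + 1) % c.n := by
    rw [Nat.mod_add_mod, Nat.add_right_comm]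
  rw [hobs j hj.le] at hq
  rw [hobs (j + 1) hj, hidx] at hq'
  rw [hact j hj] at hd ⊢
  simpa only [hidx] using hφ _ (Nat.mod_lt _ c.npos) q hq q' hq' hd
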